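/- Let T > 2 and let γ ∈ SL(2,ℤ) be hyperbolic with Frobenius norm ‖γ‖ ≤ T. Suppose that |ε_γ| is not the fundamental unit of O_K, i.e. there exists a unit λ of O_K with 1 < λ < |ε_γ|. Then either there exists an integer t with 1 ≤ t ≤ 2√T and |Tr(γ)| = t² + 2, or there exist integers k and t with 2 ≤ k ≤ 1 + log(T)/log(2), 3 ≤ t ≤ 2√T, and |Tr(γ)| = 2·T_k(t/2), where T_k is the k-th Chebyshev polynomial of the first kind. -/

import Mathlib

noncomputable section

open Matrix Polynomial

/-- `Γ = SL(2,ℤ)`. -/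
abbrev SL2Z := Matrix.SpecialLinearGroup (Fin 2) ℤ

/-- Frobenius norm of a matrix in `SL(2,ℤ)`. -/
noncomputable def frobNorm (γ : SL2Z) : ℝ :=
  Real.sqrt ((γ 0 0 ^ 2 + γ 0 1 ^ 2 + γ 1 0 ^ 2 + γ 1 1 ^ 2 : ℤ) : ℝ)

/-- Trace of a matrix in `SL(2,ℤ)`. -/
def trZ (γ : SL2Z) : ℤ := γ 0 0 + γ 1 1

/-- The absolute value `|ε_γ| = (|Tr γ| + √(Tr(γ)²-4))/2` of the large eigenvalue of a
hyperbolic matrix. -/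
noncomputable def epsAbs (γ : SL2Z) : ℝ :=
  ((|trZ γ| : ℝ) + Real.sqrt ((trZ γ : ℝ) ^ 2 - 4)) / 2

/-- `x` is a unit of the ring of integers of the real quadratic field
`K = ℚ(√(Tr(γ)²-4))`, viewed inside `ℝ`. -/
def IsUnitOfOK (γ : SL2Z) (x : ℝ) : Prop :=
  x ∈ IntermediateField.adjoin ℚ {Real.sqrt ((trZ γ : ℝ) ^ 2 - 4)} ∧
    IsIntegral ℤ x ∧ IsIntegral ℤ x⁻¹

/-- An integral real number of degree at most two over `ℚ` is a root of a monic integer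
quadratic. -/
lemma exists_int_quadratic {s x : ℝ} {D : ℤ} (hs : s ^ 2 = D)
    (hx : x ∈ IntermediateField.adjoin ℚ {s}) (hi : IsIntegral ℤ x) :
    ∃ b c : ℤ, x ^ 2 + b * x + c = 0 := by
  set p : ℚ[X] := X ^ 2 - C (D : ℚ) with hp
  have hpm : p.Monic := monic_X_pow_sub_C _ (by norm_num)
  have hps : aeval s p = 0 := by simp [hp, hs]
  have hsi : IsIntegral ℚ s := ⟨p, hpm, by simpa [aeval_def] using hps⟩
  have hdeg_s : (minpoly ℚ s).natDegree ≤ 2 := by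
    have h := natDegree_le_of_dvd (minpoly.dvd ℚ s hps) hpm.ne_zero
    rwa [hp, natDegree_X_pow_sub_C] at h
  have : FiniteDimensional ℚ (IntermediateField.adjoin ℚ {s}) :=
    IntermediateField.adjoin.finiteDimensional hsi
  have hdeg_x : (minpoly ℚ x).natDegree ≤ 2 := by
    have h := minpoly.natDegree_le (A := ℚ) (⟨x, hx⟩ : IntermediateField.adjoin ℚ {s})
    rw [IntermediateField.adjoin.finrank hsi,
      ← minpoly.algebraMap_eq (B' := ℝ) Subtype.val_injective] at h
    exact h.trans hdeg_s
  rw [minpoly.isIntegrallyClosed_eq_field_fractions' ℚ hi,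
    (minpoly.monic hi).natDegree_map] at hdeg_x
  have hpos := minpoly.natDegree_pos hi
  have hroot := minpoly.aeval ℤ x
  have hlead := minpoly.monic hi
  rw [aeval_eq_sum_range] at hroot
  unfold Monic leadingCoeff at hlead
  have hcases : (minpoly ℤ x).natDegree = 1 ∨ (minpoly ℤ x).natDegree = 2 := by omega
  rcases hcases with h | h
  · rw [h] at hroot hlead
    simp only [Finset.sum_range_succ, Finset.range_zero, Finset.sum_empty, hlead] at hroot
    simp only [zsmul_eq_mul] at hroot
    refine ⟨(minpoly ℤ x).coeff 0, 0, ?_⟩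
    push_cast at hroot ⊢
    linear_combination x * hroot
  · rw [h] at hroot hlead
    simp only [Finset.sum_range_succ, Finset.range_zero, Finset.sum_empty, hlead] at hroot
    simp only [zsmul_eq_mul] at hroot
    refine ⟨(minpoly ℤ x).coeff 1, (minpoly ℤ x).coeff 0, ?_⟩
    push_cast at hroot ⊢
    linear_combination hroot

/-- A rational number, viewed in `ℝ`, that is integral over `ℤ` is an integer. -/
lemma exists_int_of_isIntegral_rat {q : ℚ} (h : IsIntegral ℤ (q : ℝ)) : ∃ n : ℤ, (n : ℝ) = q := by
  have h' : IsIntegral ℤ q :=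
    (isIntegral_algHom_iff (Rat.castHom ℝ).toIntAlgHom Rat.cast_injective).mp (by simpa using h)
  obtain ⟨n, hn⟩ := IsIntegrallyClosed.isIntegral_iff.mp h'
  exact ⟨n, by rw [← hn]; simp⟩

/-- A unit `x > 1` of a real quadratic ring of integers has integral trace, its conjugate being
`x⁻¹` or `-x⁻¹`. -/
lemma unit_trace_int {s x : ℝ} {D : ℤ} (hs : s ^ 2 = D)
    (hx : x ∈ IntermediateField.adjoin ℚ {s}) (hi : IsIntegral ℤ x) (hi' : IsIntegral ℤ x⁻¹)
    (h1 : 1 < x) : ∃ t : ℤ, x + x⁻¹ = t ∨ x - x⁻¹ = t := by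
  have hirr : Irrational x⁻¹ := by
    rintro ⟨q, hq⟩
    obtain ⟨n, hn⟩ := exists_int_of_isIntegral_rat (hq ▸ hi')
    rw [hq] at hn
    have h0 : (0 : ℝ) < n := hn ▸ inv_pos.mpr (by linarith)
    have h2 : (n : ℝ) < 1 := hn ▸ inv_lt_one_of_one_lt₀ h1
    norm_cast at h0 h2
    omega
  have hx0 : x ≠ 0 := by positivity
  obtain ⟨b, c, hbc⟩ := exists_int_quadratic hs hx hi
  obtain ⟨b', c', hbc'⟩ := exists_int_quadratic hs (inv_mem hx) hi'
  have hy : 1 + b * x⁻¹ + c * x⁻¹ ^ 2 = 0 := by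
    field_simp
    linear_combination hbc
  have hlin : ((b - c * b' : ℤ) : ℝ) * x⁻¹ + ((1 - c * c' : ℤ) : ℝ) = 0 := by
    push_cast
    linear_combination hy - c * hbc'
  have hb : b - c * b' = 0 := by
    by_contra hne
    have := (hirr.intCast_mul hne).add_intCast (1 - c * c')
    rw [hlin] at this
    exact not_irrational_zero this
  rw [hb] at hlin
  have hc : c * c' = 1 := by
    have : ((1 - c * c' : ℤ) : ℝ) = 0 := by
      simpa only [Int.cast_zero, zero_mul, zero_add] using hlin
    have : 1 - c * c' = 0 := by exact_mod_cast this
    linarith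
  refine ⟨-b, ?_⟩
  rcases Int.eq_one_or_neg_one_of_mul_eq_one hc with rfl | rfl
  · left
    field_simp
    push_cast at hbc ⊢
    linear_combination hbc
  · right
    field_simp
    push_cast at hbc ⊢
    linear_combination hbc

lemma IsUnitOfOK.mul {γ : SL2Z} {x y : ℝ} (hx : IsUnitOfOK γ x) (hy : IsUnitOfOK γ y) :
    IsUnitOfOK γ (x * y) :=
  ⟨mul_mem hx.1 hy.1, hx.2.1.mul hy.2.1, by rw [mul_inv]; exact hx.2.2.mul hy.2.2⟩

lemma IsUnitOfOK.inv {γ : SL2Z} {x : ℝ} (hx : IsUnitOfOK γ x) : IsUnitOfOK γ x⁻¹ :=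
  ⟨inv_mem hx.1, hx.2.2, by rw [inv_inv]; exact hx.2.1⟩

lemma IsUnitOfOK.pow {γ : SL2Z} {x : ℝ} (hx : IsUnitOfOK γ x) (n : ℕ) : IsUnitOfOK γ (x ^ n) :=
  ⟨pow_mem hx.1 n, hx.2.1.pow n, by rw [← inv_pow]; exact hx.2.2.pow n⟩

lemma sqrt_disc_sq {γ : SL2Z} (h : 2 < |trZ γ|) :
    Real.sqrt ((trZ γ : ℝ) ^ 2 - 4) ^ 2 = ((trZ γ ^ 2 - 4 : ℤ) : ℝ) := by
  have h' : (2 : ℝ) < |(trZ γ : ℝ)| := by exact_mod_cast h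
  rw [Real.sq_sqrt (by nlinarith [sq_abs (trZ γ : ℝ)])]
  push_cast
  rfl

lemma IsUnitOfOK.trace_int {γ : SL2Z} (h : 2 < |trZ γ|) {x : ℝ} (hx : IsUnitOfOK γ x)
    (h1 : 1 < x) : ∃ t : ℤ, x + x⁻¹ = t ∨ x - x⁻¹ = t :=
  unit_trace_int (sqrt_disc_sq h) hx.1 hx.2.1 hx.2.2 h1

lemma epsAbs_gt_one {γ : SL2Z} (h : 2 < |trZ γ|) : 1 < epsAbs γ := by
  have h' : (2 : ℝ) < |(trZ γ : ℝ)| := by exact_mod_cast h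
  have := Real.sqrt_nonneg ((trZ γ : ℝ) ^ 2 - 4)
  unfold epsAbs
  linarith

lemma epsAbs_quadratic {γ : SL2Z} (h : 2 < |trZ γ|) :
    epsAbs γ * (|trZ γ| - epsAbs γ) = 1 := by
  have hs := sqrt_disc_sq h
  have ha := sq_abs (trZ γ : ℝ)
  unfold epsAbs
  push_cast at hs ⊢
  linear_combination (1 / 4) * ha - (1 / 4) * hs

lemma epsAbs_add_inv {γ : SL2Z} (h : 2 < |trZ γ|) :
    epsAbs γ + (epsAbs γ)⁻¹ = ((|trZ γ| : ℤ) : ℝ) := by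
  rw [inv_eq_of_mul_eq_one_right (epsAbs_quadratic h)]
  push_cast
  ring

lemma epsAbs_isUnitOfOK {γ : SL2Z} (h : 2 < |trZ γ|) : IsUnitOfOK γ (epsAbs γ) := by
  have hint : IsIntegral ℤ (epsAbs γ) := by
    refine ⟨X ^ 2 - C |trZ γ| * X + 1, by monicity!, ?_⟩
    have := epsAbs_quadratic h
    simp only [eval₂_add, eval₂_sub, eval₂_mul, eval₂_pow, eval₂_X, eval₂_C, eval₂_one,
      algebraMap_int_eq, Int.coe_castRingHom]
    linear_combination -this
  refine ⟨?_, hint, ?_⟩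
  · have hm : ((|trZ γ| : ℤ) : ℝ) ∈
        IntermediateField.adjoin ℚ {Real.sqrt ((trZ γ : ℝ) ^ 2 - 4)} := intCast_mem _ _
    have hg := IntermediateField.mem_adjoin_simple_self ℚ (Real.sqrt ((trZ γ : ℝ) ^ 2 - 4))
    rw [Int.cast_abs] at hm
    exact div_mem (add_mem hm hg) (ofNat_mem _ 2)
  · rw [inv_eq_of_mul_eq_one_right (epsAbs_quadratic h)]
    refine IsIntegral.sub ?_ hint
    exact isIntegral_algebraMap (R := ℤ) (x := |trZ γ|)

/-- Units in a bounded interval above `1` form a finite set. -/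
lemma finite_units {γ : SL2Z} (h : 2 < |trZ γ|) (B : ℝ) :
    {x : ℝ | IsUnitOfOK γ x ∧ 1 < x ∧ x ≤ B}.Finite := by
  have hinj : ∀ x y : ℝ, 1 < x → 1 < y → x + x⁻¹ = y + y⁻¹ → x = y := by
    intro x y hx hy hxy
    have : (x - y) * (x * y - 1) = 0 := by
      field_simp at hxy
      linear_combination hxy
    rcases mul_eq_zero.mp this with h | h
    · linarith
    · nlinarith
  have hinj' : ∀ x y : ℝ, 1 < x → 1 < y → x - x⁻¹ = y - y⁻¹ → x = y := by
    intro x y hx hy hxy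
    have : (x - y) * (x * y + 1) = 0 := by
      field_simp at hxy
      linear_combination hxy
    rcases mul_eq_zero.mp this with h | h
    · linarith
    · nlinarith
  have hfin : (((↑) : ℤ → ℝ) '' Set.Icc 0 ⌈B + 1⌉).Finite := (Set.finite_Icc _ _).image _
  have key : ∀ x : ℝ, 1 < x → x ≤ B → ∀ (t : ℤ) (z : ℝ), 0 ≤ z → z ≤ x + 1 → z = t →
      z ∈ ((↑) : ℤ → ℝ) '' Set.Icc 0 ⌈B + 1⌉ := by
    rintro x h1 hB t z h0 hz rfl
    refine ⟨t, ⟨by exact_mod_cast h0, ?_⟩, rfl⟩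
    have := Int.le_ceil (B + 1)
    exact_mod_cast (by linarith : (t : ℝ) ≤ ⌈B + 1⌉)
  have hA : {x : ℝ | 1 < x ∧ x + x⁻¹ ∈ ((↑) : ℤ → ℝ) '' Set.Icc 0 ⌈B + 1⌉}.Finite := by
    refine Set.Finite.of_finite_image (f := fun x : ℝ => x + x⁻¹) (hfin.subset ?_) ?_
    · rintro _ ⟨x, hx, rfl⟩
      exact hx.2
    · intro x hx y hy hxy
      exact hinj x y hx.1 hy.1 hxy
  have hA' : {x : ℝ | 1 < x ∧ x - x⁻¹ ∈ ((↑) : ℤ → ℝ) '' Set.Icc 0 ⌈B + 1⌉}.Finite := by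
    refine Set.Finite.of_finite_image (f := fun x : ℝ => x - x⁻¹) (hfin.subset ?_) ?_
    · rintro _ ⟨x, hx, rfl⟩
      exact hx.2
    · intro x hx y hy hxy
      exact hinj' x y hx.1 hy.1 hxy
  refine (hA.union hA').subset ?_
  rintro x ⟨hx, h1, hB⟩
  have hinv : 0 < x⁻¹ := inv_pos.mpr (by linarith)
  have hinv1 : x⁻¹ < 1 := inv_lt_one_of_one_lt₀ h1
  obtain ⟨t, ht | ht⟩ := hx.trace_int h h1
  · exact Or.inl ⟨h1, key x h1 hB t _ (by linarith) (by linarith) ht⟩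
  · exact Or.inr ⟨h1, key x h1 hB t _ (by linarith) (by linarith) ht⟩

/-- If `|ε_γ|` is not the fundamental unit, it is a proper power of a unit. -/
lemma exists_epsAbs_eq_pow {γ : SL2Z} (h : 2 < |trZ γ|)
    (hlam : ∃ lam : ℝ, IsUnitOfOK γ lam ∧ 1 < lam ∧ lam < epsAbs γ) :
    ∃ (μ : ℝ) (m : ℕ), IsUnitOfOK γ μ ∧ 1 < μ ∧ 2 ≤ m ∧ epsAbs γ = μ ^ m := by
  obtain ⟨lam, hu, h1, hlt⟩ := hlam
  obtain ⟨μ, ⟨hμ, hμ1, hμe⟩, hmin⟩ :=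
    (finite_units h (epsAbs γ)).exists_minimalFor id _ ⟨lam, hu, h1, hlt.le⟩
  have hleast : ∀ x : ℝ, IsUnitOfOK γ x → 1 < x → μ ≤ x := by
    intro x hx hx1
    by_contra! hlt'
    exact absurd (hmin ⟨hx, hx1, hlt'.le.trans hμe⟩ hlt'.le) (not_le.mpr hlt')
  obtain ⟨m, hm, hm'⟩ := exists_nat_pow_near (epsAbs_gt_one h).le hμ1
  have hpos : 0 < μ ^ m := by positivity
  have heq : epsAbs γ = μ ^ m := by
    by_contra hne
    have hgt : μ ^ m < epsAbs γ := lt_of_le_of_ne hm (Ne.symm hne)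
    have hle := hleast _ ((epsAbs_isUnitOfOK h).mul (hμ.pow m).inv) (by
      rw [← div_eq_mul_inv]; exact (one_lt_div hpos).mpr hgt)
    rw [← div_eq_mul_inv, le_div_iff₀ hpos, ← pow_succ'] at hle
    linarith
  refine ⟨μ, m, hμ, hμ1, ?_, heq⟩
  by_contra! hm2
  have : μ ^ m ≤ μ ^ 1 := pow_le_pow_right₀ hμ1.le (by omega)
  have := hleast lam hu h1
  rw [pow_one] at *
  linarith

lemma two_mul_chebyshevT_eval {u : ℝ} (hu : u ≠ 0) (k : ℕ) :
    2 * (Polynomial.Chebyshev.T ℝ k).eval ((u + u⁻¹) / 2) = u ^ k + (u ^ k)⁻¹ := by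
  induction k using Nat.twoStepInduction with
  | zero => norm_num
  | one => simp only [Nat.cast_one, Chebyshev.T_one, eval_X, pow_one]; ring
  | more n ih0 ih1 =>
    push_cast at ih1 ⊢
    rw [Chebyshev.T_add_two]
    simp only [eval_sub, eval_mul, eval_ofNat, eval_X]
    have : 2 * (2 * ((u + u⁻¹) / 2) * eval ((u + u⁻¹) / 2) (Chebyshev.T ℝ (n + 1)) -
        eval ((u + u⁻¹) / 2) (Chebyshev.T ℝ n)) =
        (u + u⁻¹) * (u ^ (n + 1) + (u ^ (n + 1))⁻¹) - (u ^ n + (u ^ n)⁻¹) := by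
      rw [← ih0, ← ih1]; ring
    rw [this]
    field_simp
    ring

/-- Power sums of the roots `μ, -μ⁻¹` of `X² - tX - 1` are integers. -/
lemma exists_int_pow_add_neg_inv_pow {μ : ℝ} (hμ : μ ≠ 0) {t : ℤ} (ht : μ - μ⁻¹ = t) (m : ℕ) :
    ∃ a : ℤ, μ ^ m + (-μ⁻¹) ^ m = a := by
  induction m using Nat.twoStepInduction with
  | zero => exact ⟨2, by norm_num⟩
  | one => exact ⟨t, by rw [← ht]; ring⟩
  | more n ih0 ih1 =>
    obtain ⟨a, ha⟩ := ih0
    obtain ⟨b, hb⟩ := ih1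
    refine ⟨t * b + a, ?_⟩
    have h := mul_inv_cancel₀ hμ
    push_cast
    rw [← ha, ← hb, ← ht]
    linear_combination (μ ^ n + (-μ⁻¹) ^ n) * h

lemma abs_trZ_le {γ : SL2Z} {T : ℝ} (hT : 0 ≤ T) (hnorm : frobNorm γ ≤ T) :
    ((|trZ γ| : ℤ) : ℝ) ≤ 3 / 2 * T := by
  unfold frobNorm at hnorm
  rw [Real.sqrt_le_left hT] at hnorm
  rw [Int.cast_abs]
  refine abs_le_of_sq_le_sq ?_ (by positivity)
  unfold trZ
  push_cast at hnorm ⊢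
  nlinarith [sq_nonneg ((γ 0 0 : ℝ) - γ 1 1), sq_nonneg (γ 0 1 : ℝ), sq_nonneg (γ 1 0 : ℝ)]

lemma le_two_mul_sqrt {t T : ℝ} (hT : 0 ≤ T) (h : t ^ 2 ≤ 4 * T) : t ≤ 2 * Real.sqrt T := by
  refine le_of_sq_le_sq ?_ (by positivity)
  rw [mul_pow, Real.sq_sqrt hT]
  linarith

/-- A proper power of a unit of norm `1` has Chebyshev trace, with explicit bounds. -/
lemma chebyshev_bounds {T u : ℝ} (hT : 2 < T) (hu : 1 < u) {n t : ℤ} (hn : (n : ℝ) ≤ 3 / 2 * T)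
    {k : ℕ} (hk : 2 ≤ k) (ht : u + u⁻¹ = t) (hnk : u ^ k + (u ^ k)⁻¹ = n) :
    ∃ (k : ℕ) (t : ℤ), 2 ≤ k ∧ (k : ℝ) ≤ 1 + Real.log T / Real.log 2 ∧
      3 ≤ t ∧ (t : ℝ) ≤ 2 * Real.sqrt T ∧
      (n : ℝ) = 2 * (Polynomial.Chebyshev.T ℝ k).eval ((t : ℝ) / 2) := by
  have hu0 : 0 < u := by linarith
  have hinv1 : u⁻¹ < 1 := inv_lt_one_of_one_lt₀ hu
  have hmul : u * u⁻¹ = 1 := mul_inv_cancel₀ hu0.ne'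
  have hinv0 : 0 < u⁻¹ := inv_pos.mpr hu0
  have ht3 : 3 ≤ t := by
    have : (2 : ℝ) < t := by
      rw [← ht]
      nlinarith [mul_pos (sub_pos.mpr hu) (sub_pos.mpr hinv1)]
    exact_mod_cast this
  have ht3' : (3 : ℝ) ≤ t := by exact_mod_cast ht3
  have hu2 : 2 ≤ u := by linarith
  have hukn : u ^ k ≤ n := by
    rw [← hnk]
    have : 0 < (u ^ k)⁻¹ := by positivity
    linarith
  refine ⟨k, t, hk, ?_, ht3, ?_, ?_⟩
  · have h2 : (2 : ℝ) ^ k ≤ 2 * T := by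
      have := pow_le_pow_left₀ (by norm_num) hu2 k
      linarith
    have hl := Real.log_le_log (by positivity) h2
    rw [Real.log_pow, Real.log_mul (by norm_num) (by linarith)] at hl
    have hl2 : 0 < Real.log 2 := Real.log_pos (by norm_num)
    rw [← sub_le_iff_le_add', le_div_iff₀ hl2]
    linarith
  · refine le_two_mul_sqrt (by linarith) ?_
    have : u ^ 2 ≤ u ^ k := pow_le_pow_right₀ hu.le hk
    rw [← ht]
    nlinarith
  · rw [← ht, two_mul_chebyshevT_eval hu0.ne', hnk]

/-- Let `T > 2` and `γ ∈ SL(2,ℤ)` hyperbolic with `‖γ‖ ≤ T`; if `|ε_γ|` is not the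
fundamental unit of `O_K` (i.e. some unit `λ` of `O_K` satisfies `1 < λ < |ε_γ|`), then
either `|Tr(γ)| = t² + 2` for an integer `1 ≤ t ≤ 2√T`, or `|Tr(γ)| = 2·T_k(t/2)` for
integers `2 ≤ k ≤ 1 + log T/log 2` and `3 ≤ t ≤ 2√T`. -/
theorem statement5 (T : ℝ) (hT : 2 < T) (γ : SL2Z) (hhyp : 2 < |trZ γ|)
    (hnorm : frobNorm γ ≤ T)
    (hlam : ∃ lam : ℝ, IsUnitOfOK γ lam ∧ 1 < lam ∧ lam < epsAbs γ) :
    (∃ t : ℤ, 1 ≤ t ∧ (t : ℝ) ≤ 2 * Real.sqrt T ∧ |trZ γ| = t ^ 2 + 2) ∨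
    (∃ (k : ℕ) (t : ℤ), 2 ≤ k ∧ (k : ℝ) ≤ 1 + Real.log T / Real.log 2 ∧
      3 ≤ t ∧ (t : ℝ) ≤ 2 * Real.sqrt T ∧
      ((|trZ γ| : ℤ) : ℝ) = 2 * (Polynomial.Chebyshev.T ℝ k).eval ((t : ℝ) / 2)) := by
  have hn := abs_trZ_le (by linarith) hnorm
  obtain ⟨μ, m, hμ, hμ1, hm, heq⟩ := exists_epsAbs_eq_pow hhyp hlam
  have htr := epsAbs_add_inv hhyp
  rw [heq] at htr
  have hμ0 : μ ≠ 0 := by positivity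
  obtain ⟨t, ht | ht⟩ := hμ.trace_int hhyp hμ1
  · exact Or.inr (chebyshev_bounds hT hμ1 hn hm ht htr)
  rcases Nat.even_or_odd m with ⟨j, rfl⟩ | hodd
  · have hν1 : 1 < μ ^ j := one_lt_pow₀ hμ1 (by omega)
    have hν0 : μ ^ j ≠ 0 := by positivity
    rw [← two_mul, mul_comm, pow_mul] at htr
    obtain ⟨r, hr | hr⟩ := (hμ.pow j).trace_int hhyp hν1
    · exact Or.inr (chebyshev_bounds hT hν1 hn le_rfl hr htr)
    · have hsq : ((|trZ γ| : ℤ) : ℝ) = (r : ℝ) ^ 2 + 2 := by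
        rw [← htr, ← hr]
        field_simp
        ring
      refine Or.inl ⟨r, ?_, le_two_mul_sqrt (by linarith) (by linarith), by exact_mod_cast hsq⟩
      have : (0 : ℝ) < r := by
        rw [← hr]
        linarith [inv_lt_one_of_one_lt₀ hν1]
      exact_mod_cast this
  · exfalso
    obtain ⟨a, ha⟩ := exists_int_pow_add_neg_inv_pow hμ0 ht m
    rw [hodd.neg_pow, inv_pow] at ha
    have hsq : ((|trZ γ| ^ 2 : ℤ) : ℝ) = ((a ^ 2 + 4 : ℤ) : ℝ) := by
      have hmul := mul_inv_cancel₀ (pow_ne_zero m hμ0)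
      push_cast at htr ⊢
      rw [← htr, ← ha]
      linear_combination 4 * hmul
    have hsq' : |trZ γ| ^ 2 = |a| ^ 2 + 4 := by
      rw [sq_abs a]
      exact_mod_cast hsq
    have : |a| < |trZ γ| := lt_of_pow_lt_pow_left₀ 2 (abs_nonneg _) (by linarith)
    nlinarith [abs_nonneg a]
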